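/- Let $\mathbf{u}, \dot{\mathbf{u}} \colon B_R \to \mathbb{R}^2$ be smooth with $\mathbf{u}$ vanishing on $\partial B_R$, and let $J_1 = \mu\int_{B_R} \dot{u}^j\left(\partial_t \Delta u^j + \mathrm{div}(\mathbf{u}\Delta u^j)\right) dx$ where $\dot{\mathbf{u}} = \mathbf{u}_t + \mathbf{u}\cdot\nabla\mathbf{u}$. Then the integration-by-parts identity holds: $J_1 = -\mu\int_{B_R}\left(|\nabla\dot{\mathbf{u}}|^2 + \partial_i\dot{u}^j\,\partial_k u^k\,\partial_i u^j - \partial_i\dot{u}^j\,\partial_i u^k\,\partial_k u^j - \partial_i u^j\,\partial_i u^k\,\partial_k\dot{u}^j\right)dx$, and consequently $J_1 \le -\frac{3\mu}{4}\|\nabla\dot{\mathbf{u}}\|_{L^2(B_R)}^2 + C(\mu)\|\nabla\mathbf{u}\|_{L^4(B_R)}^4$. -/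

import Mathlib

open MeasureTheory Metric Real

noncomputable section

abbrev E19 := EuclideanSpace ℝ (Fin 2)

def pd19 (f : E19 → ℝ) (i : Fin 2) (x : E19) : ℝ :=
  fderiv ℝ f x (EuclideanSpace.single i 1)

def div19 (v : E19 → Fin 2 → ℝ) (x : E19) : ℝ :=
  ∑ i, pd19 (fun y => v y i) i x

def lap19 (f : E19 → ℝ) (x : E19) : ℝ :=
  ∑ i, pd19 (pd19 f i) i x

/-- The directional derivative of a function on space-time. -/
def dirDeriv (v : ℝ × E19) (f : ℝ × E19 → ℝ) : ℝ × E19 → ℝ :=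
  fun p => fderiv ℝ f p v

/-- The `i`-th spatial unit vector in space-time. -/
def spaceVec (i : Fin 2) : ℝ × E19 := (0, EuclideanSpace.single i 1)

theorem contDiff_dirDeriv (v : ℝ × E19) {f : ℝ × E19 → ℝ}
    (hf : ContDiff ℝ (⊤ : ℕ∞) f) : ContDiff ℝ (⊤ : ℕ∞) (dirDeriv v f) := by
  have h : ContDiff ℝ (⊤ : ℕ∞) (fderiv ℝ f) := hf.fderiv_right (by simp)
  exact h.clm_apply contDiff_const

theorem dirDeriv_add (v : ℝ × E19) {f g : ℝ × E19 → ℝ}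
    (hf : ContDiff ℝ (⊤ : ℕ∞) f) (hg : ContDiff ℝ (⊤ : ℕ∞) g) :
    dirDeriv v (f + g) = dirDeriv v f + dirDeriv v g := by
  ext p
  simp [dirDeriv, fderiv_add (hf.differentiable (by simp) p) (hg.differentiable (by simp) p)]

theorem dirDeriv_sub (v : ℝ × E19) {f g : ℝ × E19 → ℝ}
    (hf : ContDiff ℝ (⊤ : ℕ∞) f) (hg : ContDiff ℝ (⊤ : ℕ∞) g) :
    dirDeriv v (f - g) = dirDeriv v f - dirDeriv v g := by
  ext p
  simp [dirDeriv, fderiv_sub (hf.differentiable (by simp) p) (hg.differentiable (by simp) p)]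

theorem dirDeriv_mul (v : ℝ × E19) {f g : ℝ × E19 → ℝ}
    (hf : ContDiff ℝ (⊤ : ℕ∞) f) (hg : ContDiff ℝ (⊤ : ℕ∞) g) :
    dirDeriv v (f * g) = dirDeriv v f * g + f * dirDeriv v g := by
  ext p
  simp [dirDeriv, fderiv_mul (hf.differentiable (by simp) p) (hg.differentiable (by simp) p)]
  ring

theorem dirDeriv_comm (v w : ℝ × E19) {f : ℝ × E19 → ℝ} (hf : ContDiff ℝ (⊤ : ℕ∞) f) :
    dirDeriv v (dirDeriv w f) = dirDeriv w (dirDeriv v f) := by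
  have h : ContDiff ℝ (⊤ : ℕ∞) (fderiv ℝ f) := hf.fderiv_right (by simp)
  have key (v w : ℝ × E19) (p : ℝ × E19) :
      dirDeriv v (dirDeriv w f) p = fderiv ℝ (fderiv ℝ f) p v w := by
    unfold dirDeriv
    rw [fderiv_clm_apply (h.differentiable (by simp) p) (differentiableAt_const w)]
    simp
  ext p
  rw [key, key]
  have hs : IsSymmSndFDerivAt ℝ f p := by
    apply hf.contDiffAt.isSymmSndFDerivAt
    simp only [minSmoothness_of_isRCLikeNormedField]
    exact WithTop.coe_le_coe.2 le_top
  exact hs v w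

theorem pd19_slice {f : ℝ × E19 → ℝ} (hf : ContDiff ℝ (⊤ : ℕ∞) f) (i : Fin 2) (t : ℝ) (x : E19) :
    pd19 (fun y => f (t, y)) i x = dirDeriv (spaceVec i) f (t, x) := by
  have h1 := (hf.differentiable (by simp) (t, x)).hasFDerivAt
  have h2 := h1.comp x (hasFDerivAt_prodMk_right (𝕜 := ℝ) t x)
  unfold pd19 dirDeriv spaceVec
  erw [h2.fderiv]
  simp

theorem deriv_slice {f : ℝ × E19 → ℝ} (hf : ContDiff ℝ (⊤ : ℕ∞) f) (t : ℝ) (x : E19) :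
    deriv (fun s => f (s, x)) t = dirDeriv (1, 0) f (t, x) := by
  have h1 := (hf.differentiable (by simp) (t, x)).hasFDerivAt
  have h2 := h1.comp_hasDerivAt t ((hasDerivAt_id t).prodMk (hasDerivAt_const t x))
  exact h2.deriv

/-- The spatial Laplacian on space-time. -/
def spaceLap (f : ℝ × E19 → ℝ) : ℝ × E19 → ℝ :=
  dirDeriv (spaceVec 0) (dirDeriv (spaceVec 0) f) + dirDeriv (spaceVec 1) (dirDeriv (spaceVec 1) f)

theorem contDiff_spaceLap {f : ℝ × E19 → ℝ} (hf : ContDiff ℝ (⊤ : ℕ∞) f) :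
    ContDiff ℝ (⊤ : ℕ∞) (spaceLap f) :=
  (contDiff_dirDeriv _ (contDiff_dirDeriv _ hf)).add
    (contDiff_dirDeriv _ (contDiff_dirDeriv _ hf))

theorem lap19_slice {f : ℝ × E19 → ℝ} (hf : ContDiff ℝ (⊤ : ℕ∞) f) (t : ℝ) (x : E19) :
    lap19 (fun y => f (t, y)) x = spaceLap f (t, x) := by
  have h (i : Fin 2) : pd19 (fun y => f (t, y)) i
      = fun y => dirDeriv (spaceVec i) f (t, y) := funext fun y => pd19_slice hf i t y
  simp only [lap19, h, pd19_slice (contDiff_dirDeriv _ hf), Fin.sum_univ_two, spaceLap,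
    Pi.add_apply]

/-- The flux whose divergence, tested against the material derivative `W`, gives the commutator. -/
def commFlux (U : Fin 2 → ℝ × E19 → ℝ) (W : Fin 2 → ℝ × E19 → ℝ) (i j : Fin 2) : ℝ × E19 → ℝ :=
  dirDeriv (spaceVec i) (W j)
    + (dirDeriv (spaceVec 0) (U 0) + dirDeriv (spaceVec 1) (U 1)) * dirDeriv (spaceVec i) (U j)
    - (dirDeriv (spaceVec i) (U 0) * dirDeriv (spaceVec 0) (U j)
      + dirDeriv (spaceVec i) (U 1) * dirDeriv (spaceVec 1) (U j))
    - (dirDeriv (spaceVec 0) (U i) * dirDeriv (spaceVec 0) (U j)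
      + dirDeriv (spaceVec 1) (U i) * dirDeriv (spaceVec 1) (U j))

theorem contDiff_mul_pi {f g : ℝ × E19 → ℝ} (hf : ContDiff ℝ (⊤ : ℕ∞) f)
    (hg : ContDiff ℝ (⊤ : ℕ∞) g) : ContDiff ℝ (⊤ : ℕ∞) (f * g) := hf.mul hg

theorem contDiff_add_pi {f g : ℝ × E19 → ℝ} (hf : ContDiff ℝ (⊤ : ℕ∞) f)
    (hg : ContDiff ℝ (⊤ : ℕ∞) g) : ContDiff ℝ (⊤ : ℕ∞) (f + g) := hf.add hg

theorem contDiff_sub_pi {f g : ℝ × E19 → ℝ} (hf : ContDiff ℝ (⊤ : ℕ∞) f)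
    (hg : ContDiff ℝ (⊤ : ℕ∞) g) : ContDiff ℝ (⊤ : ℕ∞) (f - g) := hf.sub hg

theorem contDiff_commFlux {U W : Fin 2 → ℝ × E19 → ℝ} (hU : ∀ j, ContDiff ℝ (⊤ : ℕ∞) (U j))
    (hW : ∀ j, ContDiff ℝ (⊤ : ℕ∞) (W j)) (i j : Fin 2) :
    ContDiff ℝ (⊤ : ℕ∞) (commFlux U W i j) := by
  unfold commFlux
  simp (maxDischargeDepth := 20) only [contDiff_mul_pi, contDiff_add_pi, contDiff_sub_pi, contDiff_dirDeriv, hU, hW]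

theorem commutator_eq_div_commFlux {U W : Fin 2 → ℝ × E19 → ℝ}
    (hU : ∀ j, ContDiff ℝ (⊤ : ℕ∞) (U j)) (hW : ∀ j, ContDiff ℝ (⊤ : ℕ∞) (W j))
    (j : Fin 2)
    (hUW : W j = dirDeriv (1, 0) (U j) + (U 0 * dirDeriv (spaceVec 0) (U j)
      + U 1 * dirDeriv (spaceVec 1) (U j))) :
    dirDeriv (1, 0) (spaceLap (U j)) + (dirDeriv (spaceVec 0) (U 0 * spaceLap (U j))
        + dirDeriv (spaceVec 1) (U 1 * spaceLap (U j)))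
      = dirDeriv (spaceVec 0) (commFlux U W 0 j) + dirDeriv (spaceVec 1) (commFlux U W 1 j) := by
  have ht : dirDeriv (1, 0) (U j) = W j - (U 0 * dirDeriv (spaceVec 0) (U j)
      + U 1 * dirDeriv (spaceVec 1) (U j)) := by rw [hUW]; ring
  have h1 (i : Fin 2) : dirDeriv (1, 0) (dirDeriv (spaceVec i) (dirDeriv (spaceVec i) (U j)))
      = dirDeriv (spaceVec i) (dirDeriv (spaceVec i) (dirDeriv (1, 0) (U j))) := by
    rw [dirDeriv_comm _ _ (contDiff_dirDeriv _ (hU j)), dirDeriv_comm (1, 0) _ (hU j)]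
  have hc {f : ℝ × E19 → ℝ} (hf : ContDiff ℝ (⊤ : ℕ∞) f) :
      dirDeriv (spaceVec 1) (dirDeriv (spaceVec 0) f)
        = dirDeriv (spaceVec 0) (dirDeriv (spaceVec 1) f) := dirDeriv_comm _ _ hf
  unfold spaceLap commFlux
  rw [dirDeriv_add _ (contDiff_dirDeriv _ (contDiff_dirDeriv _ (hU j)))
    (contDiff_dirDeriv _ (contDiff_dirDeriv _ (hU j))), h1, h1, ht]
  simp (maxDischargeDepth := 20) only [dirDeriv_add, dirDeriv_sub, dirDeriv_mul, hc, contDiff_mul_pi, contDiff_add_pi,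
    contDiff_sub_pi, contDiff_dirDeriv, hU, hW]
  ring

theorem lipschitzWith_indicator_ball {R : ℝ} {g : E19 → ℝ} (hg : ContDiff ℝ 1 g)
    (h0 : ∀ x ∈ sphere (0 : E19) R, g x = 0) :
    ∃ K, LipschitzWith K ((ball (0 : E19) R).indicator g) := by
  have hdc : Continuous (fun x => ‖fderiv ℝ g x‖₊) := (hg.continuous_fderiv (by simp)).nnnorm
  obtain ⟨K, hK⟩ := ((isCompact_closedBall (0 : E19) R).image hdc).bddAbove
  have hL : LipschitzOnWith K g (closedBall (0 : E19) R) :=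
    (convex_closedBall 0 R).lipschitzOnWith_of_nnnorm_fderiv_le
      (fun x _ => hg.differentiable (by simp) x)
      (fun x hx => hK (Set.mem_image_of_mem _ hx))
  have mixed : ∀ x ∈ ball (0 : E19) R, ∀ y ∉ ball (0 : E19) R, |g x| ≤ K * dist x y := by
    intro x hx y hy
    obtain ⟨z, hz, hzR⟩ := (convex_segment x y).isPreconnected.intermediate_value
      (left_mem_segment ℝ x y) (right_mem_segment ℝ x y) continuous_norm.continuousOn
      (show R ∈ Set.Icc ‖x‖ ‖y‖ from
        ⟨(mem_ball_zero_iff.1 hx).le, not_lt.1 fun h => hy (mem_ball_zero_iff.2 h)⟩)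
    have hzf : z ∈ sphere (0 : E19) R := mem_sphere_zero_iff_norm.2 hzR
    have h1 := hL.dist_le_mul x (ball_subset_closedBall hx) z (sphere_subset_closedBall hzf)
    rw [h0 z hzf, Real.dist_eq, sub_zero] at h1
    have h2 := dist_add_dist_of_mem_segment hz
    refine h1.trans (mul_le_mul_of_nonneg_left ?_ K.2)
    linarith [dist_nonneg (x := z) (y := y)]
  refine ⟨K, LipschitzWith.of_dist_le_mul fun x y => ?_⟩
  by_cases hx : x ∈ ball (0 : E19) R <;> by_cases hy : y ∈ ball (0 : E19) R
  · simpa only [Set.indicator_of_mem hx, Set.indicator_of_mem hy] using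
      hL.dist_le_mul x (ball_subset_closedBall hx) y (ball_subset_closedBall hy)
  · simpa only [Set.indicator_of_mem hx, Set.indicator_of_notMem hy, Real.dist_eq, sub_zero]
      using mixed x hx y hy
  · simpa only [Set.indicator_of_notMem hx, Set.indicator_of_mem hy, Real.dist_eq, zero_sub,
      abs_neg, dist_comm x y] using mixed y hy x hx
  · simp only [Set.indicator_of_notMem hx, Set.indicator_of_notMem hy, dist_self]
    positivity

/-- The integral over a ball of a partial derivative of a function vanishing on the boundary. -/
theorem integral_pd19_ball_eq_zero {R : ℝ} (hR : 0 < R) {g : E19 → ℝ} (hg : ContDiff ℝ 1 g)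
    (h0 : ∀ x ∈ sphere (0 : E19) R, g x = 0) (i : Fin 2) :
    ∫ x in ball (0 : E19) R, pd19 g i x = 0 := by
  obtain ⟨K, hK⟩ := lipschitzWith_indicator_ball hg h0
  set v : E19 := EuclideanSpace.single i 1
  have hcs : HasCompactSupport ((ball (0 : E19) R).indicator g) :=
    HasCompactSupport.intro (isCompact_closedBall (0 : E19) R) fun x hx =>
      Set.indicator_of_notMem (fun h => hx (ball_subset_closedBall h)) _
  have key := (LipschitzWith.const (1 : ℝ) (α := E19)).integral_lineDeriv_mul_eq
    (μ := volume) hK hcs (-v)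
  have hz (x : E19) : lineDeriv ℝ (fun _ : E19 => (1 : ℝ)) x (-v) = 0 := by simp [lineDeriv]
  simp only [hz, zero_mul, integral_zero, mul_one, neg_neg] at key
  rw [key, ← integral_indicator measurableSet_ball]
  refine integral_congr_ae ?_
  have hs : ∀ᵐ x : E19, x ∉ sphere (0 : E19) R :=
    measure_eq_zero_iff_ae_notMem.1 (Measure.addHaar_sphere_of_ne_zero volume 0 hR.ne')
  filter_upwards [hs] with x hx
  by_cases hb : x ∈ ball (0 : E19) R
  · rw [Set.indicator_of_mem hb]
    have he : (ball (0 : E19) R).indicator g =ᶠ[nhds x] g := by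
      filter_upwards [isOpen_ball.mem_nhds hb] with y hy using Set.indicator_of_mem hy _
    rw [he.lineDeriv_eq, (hg.differentiable (by simp) x).lineDeriv_eq_fderiv]
    rfl
  · rw [Set.indicator_of_notMem hb]
    have hc : x ∈ (closedBall (0 : E19) R)ᶜ := by
      simp only [mem_ball, mem_sphere, Set.mem_compl_iff, mem_closedBall, not_lt, not_le] at *
      exact lt_of_le_of_ne hb (Ne.symm hx)
    have he : (ball (0 : E19) R).indicator g =ᶠ[nhds x] fun _ => 0 := by
      filter_upwards [isClosed_closedBall.isOpen_compl.mem_nhds hc] with y hy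
        using Set.indicator_of_notMem (fun h => hy (ball_subset_closedBall h)) _
    rw [he.lineDeriv_eq]
    simp [lineDeriv]

theorem abs_mul_mul_le_of_sq_le {p q r b : ℝ} (hq : q ^ 2 ≤ b) (hr : r ^ 2 ≤ b) :
    |p * q * r| ≤ p ^ 2 / 24 + 6 * b ^ 2 := by
  have h1 : q ^ 2 * r ^ 2 ≤ b ^ 2 := by
    rw [sq b]; exact mul_le_mul hq hr (sq_nonneg _) ((sq_nonneg q).trans hq)
  rw [abs_le]
  constructor <;> nlinarith [sq_nonneg (p - 12 * (q * r)), sq_nonneg (p + 12 * (q * r))]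

/-- Young's inequality for the cubic terms of the commutator identity. -/
theorem commutator_young (a b : Fin 2 → Fin 2 → ℝ) :
    3 / 4 * (∑ i, ∑ j, a i j ^ 2) - 144 * (∑ i, ∑ j, b i j ^ 2) ^ 2
      ≤ (∑ i, ∑ j, a i j ^ 2) + (∑ i, ∑ j, ∑ k, a i j * b k k * b i j)
        - (∑ i, ∑ j, ∑ k, a i j * b i k * b k j)
        - (∑ i, ∑ j, ∑ k, b i j * b i k * a k j) := by
  set B := ∑ i, ∑ j, b i j ^ 2 with hB
  have hb (i j : Fin 2) : b i j ^ 2 ≤ B :=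
    (Finset.single_le_sum (f := fun j => b i j ^ 2) (fun _ _ => sq_nonneg _)
      (Finset.mem_univ j)).trans
      (Finset.single_le_sum (f := fun i => ∑ j, b i j ^ 2)
        (fun _ _ => Finset.sum_nonneg fun _ _ => sq_nonneg _) (Finset.mem_univ i))
  have h1 : ∑ i, ∑ j, ∑ k, -(a i j ^ 2 / 24 + 6 * B ^ 2) ≤ ∑ i, ∑ j, ∑ k, a i j * b k k * b i j :=
    Finset.sum_le_sum fun i _ => Finset.sum_le_sum fun j _ => Finset.sum_le_sum fun k _ =>
      (abs_le.1 (abs_mul_mul_le_of_sq_le (hb k k) (hb i j))).1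
  have h2 : ∑ i, ∑ j, ∑ k, a i j * b i k * b k j ≤ ∑ i, ∑ j, ∑ k, (a i j ^ 2 / 24 + 6 * B ^ 2) :=
    Finset.sum_le_sum fun i _ => Finset.sum_le_sum fun j _ => Finset.sum_le_sum fun k _ =>
      (abs_le.1 (abs_mul_mul_le_of_sq_le (hb i k) (hb k j))).2
  have h3 : ∑ i, ∑ j, ∑ k, b i j * b i k * a k j ≤ ∑ i, ∑ j, ∑ k, (a k j ^ 2 / 24 + 6 * B ^ 2) :=
    Finset.sum_le_sum fun i _ => Finset.sum_le_sum fun j _ => Finset.sum_le_sum fun k _ => by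
      have := (abs_le.1 (abs_mul_mul_le_of_sq_le (p := a k j) (hb i j) (hb i k))).2
      linarith
  clear_value B
  simp only [Fin.sum_univ_two] at h1 h2 h3 ⊢
  linarith

theorem integrableOn_ball_of_continuous {f : E19 → ℝ} (hf : Continuous f) (R : ℝ) :
    IntegrableOn f (ball (0 : E19) R) :=
  (hf.continuousOn.integrableOn_compact (isCompact_closedBall (0 : E19) R)).mono_set
    ball_subset_closedBall

/-- Estimate (3.21) in Lemma 3.4: the integration-by-parts identity for
`J₁ = μ∫ u̇ʲ(∂ₜΔuʲ + div(uΔuʲ))` and the resulting bound. -/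
theorem stmt19 (μ : ℝ) (hμ : 0 < μ) :
    ∃ C > 0, ∀ (R T : ℝ), 0 < R → 0 < T →
    ∀ (u : ℝ → E19 → E19) (w : ℝ → E19 → Fin 2 → ℝ),
      (∀ j : Fin 2, ContDiff ℝ (⊤ : ℕ∞) (fun p : ℝ × E19 => u p.1 p.2 j)) →
      (∀ j : Fin 2, ContDiff ℝ (⊤ : ℕ∞) (fun p : ℝ × E19 => w p.1 p.2 j)) →
      -- w is the material derivative u̇ = u_t + u·∇u
      (∀ t x j, w t x j = deriv (fun s => u s x j) t
          + ∑ i, u t x i * pd19 (fun y => u t y j) i x) →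
      (∀ t ∈ Set.Icc 0 T, ∀ x ∈ sphere (0 : E19) R, u t x = 0) →
      ∀ t ∈ Set.Ioo 0 T,
        (μ * ∫ x in ball (0 : E19) R, ∑ j,
            w t x j * (deriv (fun s => lap19 (fun y => u s y j) x) t
              + div19 (fun y i => u t y i * lap19 (fun z => u t z j) y) x))
          = -μ * ∫ x in ball (0 : E19) R,
              ((∑ i, ∑ j, (pd19 (fun y => w t y j) i x) ^ 2)
                + (∑ i, ∑ j, ∑ k, pd19 (fun y => w t y j) i x
                    * pd19 (fun y => u t y k) k x * pd19 (fun y => u t y j) i x)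
                - (∑ i, ∑ j, ∑ k, pd19 (fun y => w t y j) i x
                    * pd19 (fun y => u t y k) i x * pd19 (fun y => u t y j) k x)
                - (∑ i, ∑ j, ∑ k, pd19 (fun y => u t y j) i x
                    * pd19 (fun y => u t y k) i x * pd19 (fun y => w t y j) k x))
        ∧ (μ * ∫ x in ball (0 : E19) R, ∑ j,
            w t x j * (deriv (fun s => lap19 (fun y => u s y j) x) t
              + div19 (fun y i => u t y i * lap19 (fun z => u t z j) y) x))
          ≤ -(3 * μ / 4) * (∫ x in ball (0 : E19) R,
                ∑ i, ∑ j, (pd19 (fun y => w t y j) i x) ^ 2)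
            + C * ∫ x in ball (0 : E19) R,
                (∑ i, ∑ j, (pd19 (fun y => u t y j) i x) ^ 2) ^ 2 := by
  refine ⟨144 * μ, by positivity, ?_⟩
  intro R T hR _ u w hu hw hwu hbd t ht
  set U : Fin 2 → ℝ × E19 → ℝ := fun j p => u p.1 p.2 j with hUdef
  set W : Fin 2 → ℝ × E19 → ℝ := fun j p => w p.1 p.2 j with hWdef
  have hU : ∀ j, ContDiff ℝ (⊤ : ℕ∞) (U j) := hu
  have hW : ∀ j, ContDiff ℝ (⊤ : ℕ∞) (W j) := hw
  have pu (s : ℝ) (i j : Fin 2) (x : E19) :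
      pd19 (fun y => u s y j) i x = dirDeriv (spaceVec i) (U j) (s, x) := pd19_slice (hU j) i s x
  have pw (s : ℝ) (i j : Fin 2) (x : E19) :
      pd19 (fun y => w s y j) i x = dirDeriv (spaceVec i) (W j) (s, x) := pd19_slice (hW j) i s x
  have lu (s : ℝ) (j : Fin 2) (x : E19) :
      lap19 (fun y => u s y j) x = spaceLap (U j) (s, x) := lap19_slice (hU j) s x
  have hUW (j : Fin 2) : W j = dirDeriv (1, 0) (U j) + (U 0 * dirDeriv (spaceVec 0) (U j)
      + U 1 * dirDeriv (spaceVec 1) (U j)) := by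
    ext ⟨s, x⟩
    have h := hwu s x j
    rw [show deriv (fun s => u s x j) s = dirDeriv (1, 0) (U j) (s, x) from
      deriv_slice (hU j) s x] at h
    simp only [Fin.sum_univ_two, pu] at h
    exact h
  have hW0 : ∀ x ∈ sphere (0 : E19) R, ∀ j, W j (t, x) = 0 := by
    intro x hx j
    have hd : deriv (fun s => u s x j) t = 0 := by
      have he : (fun s => u s x j) =ᶠ[nhds t] fun _ => (0 : ℝ) := by
        filter_upwards [Icc_mem_nhds ht.1 ht.2] with s hs
        simp [hbd s hs x hx]
      rw [he.deriv_eq, deriv_const]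
    have h := hwu t x j
    simpa [hd, hbd t (Set.Ioo_subset_Icc_self ht) x hx] using h
  set G : Fin 2 → ℝ × E19 → ℝ := fun i => W 0 * commFlux U W i 0 + W 1 * commFlux U W i 1 with hG
  have hF := contDiff_commFlux hU hW
  have hGs (i : Fin 2) : ContDiff ℝ (⊤ : ℕ∞) (G i) :=
    contDiff_add_pi (contDiff_mul_pi (hW 0) (hF i 0)) (contDiff_mul_pi (hW 1) (hF i 1))
  have hGint (i : Fin 2) :
      ∫ x in ball (0 : E19) R, dirDeriv (spaceVec i) (G i) (t, x) = 0 := by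
    simp only [← pd19_slice (hGs i)]
    refine integral_pd19_ball_eq_zero hR
      (((hGs i).of_le (by simp)).comp (contDiff_prodMk_right t)) (fun x hx => ?_) i
    simp [hG, hW0 x hx]
  have slice {f : ℝ × E19 → ℝ} (hf : ContDiff ℝ (⊤ : ℕ∞) f) : Continuous fun x => f (t, x) :=
    hf.continuous.comp (by fun_prop)
  have cu (i j : Fin 2) := slice (contDiff_dirDeriv (spaceVec i) (hU j))
  have cw (i j : Fin 2) := slice (contDiff_dirDeriv (spaceVec i) (hW j))
  have cG (i : Fin 2) := slice (contDiff_dirDeriv (spaceVec i) (hGs i))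
  have hlhs (x : E19) : (∑ j, w t x j * (deriv (fun s => lap19 (fun y => u s y j) x) t
      + div19 (fun y i => u t y i * lap19 (fun z => u t z j) y) x))
      = (dirDeriv (spaceVec 0) (G 0) (t, x) + dirDeriv (spaceVec 1) (G 1) (t, x))
        - ((∑ i, ∑ j, (pd19 (fun y => w t y j) i x) ^ 2)
                + (∑ i, ∑ j, ∑ k, pd19 (fun y => w t y j) i x
                    * pd19 (fun y => u t y k) k x * pd19 (fun y => u t y j) i x)
                - (∑ i, ∑ j, ∑ k, pd19 (fun y => w t y j) i x
                    * pd19 (fun y => u t y k) i x * pd19 (fun y => u t y j) k x)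
                - (∑ i, ∑ j, ∑ k, pd19 (fun y => u t y j) i x
                    * pd19 (fun y => u t y k) i x * pd19 (fun y => w t y j) k x)) := by
    have hdiv (i j : Fin 2) : pd19 (fun y => u t y i * spaceLap (U j) (t, y)) i x
        = dirDeriv (spaceVec i) (U i * spaceLap (U j)) (t, x) :=
      pd19_slice (contDiff_mul_pi (hU i) (contDiff_spaceLap (hU j))) i t x
    have hcomm (j : Fin 2) := congrFun (commutator_eq_div_commFlux hU hW j (hUW j)) (t, x)
    have hGd (i : Fin 2) : dirDeriv (spaceVec i) (G i) =
        (dirDeriv (spaceVec i) (W 0) * commFlux U W i 0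
          + W 0 * dirDeriv (spaceVec i) (commFlux U W i 0))
        + (dirDeriv (spaceVec i) (W 1) * commFlux U W i 1
          + W 1 * dirDeriv (spaceVec i) (commFlux U W i 1)) := by
      simp only [hG, dirDeriv_add, dirDeriv_mul, contDiff_mul_pi, hW, hF]
    have hw' (j : Fin 2) : w t x j = W j (t, x) := rfl
    simp only [Pi.add_apply] at hcomm
    simp only [lu, deriv_slice (contDiff_spaceLap (hU _)), div19, hdiv, pu, pw, hw', hGd,
      Fin.sum_univ_two, hcomm, Pi.add_apply, Pi.mul_apply]
    simp only [commFlux, Pi.add_apply, Pi.mul_apply, Pi.sub_apply]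
    ring
  have hid : (∫ x in ball (0 : E19) R, ∑ j,
      w t x j * (deriv (fun s => lap19 (fun y => u s y j) x) t
        + div19 (fun y i => u t y i * lap19 (fun z => u t z j) y) x))
      = -∫ x in ball (0 : E19) R, ((∑ i, ∑ j, (pd19 (fun y => w t y j) i x) ^ 2)
                + (∑ i, ∑ j, ∑ k, pd19 (fun y => w t y j) i x
                    * pd19 (fun y => u t y k) k x * pd19 (fun y => u t y j) i x)
                - (∑ i, ∑ j, ∑ k, pd19 (fun y => w t y j) i x
                    * pd19 (fun y => u t y k) i x * pd19 (fun y => u t y j) k x)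
                - (∑ i, ∑ j, ∑ k, pd19 (fun y => u t y j) i x
                    * pd19 (fun y => u t y k) i x * pd19 (fun y => w t y j) k x)) := by
    simp only [hlhs]
    rw [integral_sub, integral_add, hGint, hGint]
    · ring
    · exact integrableOn_ball_of_continuous (cG 0) R
    · exact integrableOn_ball_of_continuous (cG 1) R
    · exact integrableOn_ball_of_continuous ((cG 0).add (cG 1)) R
    · refine integrableOn_ball_of_continuous ?_ R
      simp only [pu, pw]
      fun_prop
  rw [hid]
  refine ⟨by ring, ?_⟩
  have hle : 3 / 4 * (∫ x in ball (0 : E19) R, ∑ i, ∑ j, (pd19 (fun y => w t y j) i x) ^ 2)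
      - 144 * (∫ x in ball (0 : E19) R, (∑ i, ∑ j, (pd19 (fun y => u t y j) i x) ^ 2) ^ 2)
      ≤ ∫ x in ball (0 : E19) R, ((∑ i, ∑ j, (pd19 (fun y => w t y j) i x) ^ 2)
                + (∑ i, ∑ j, ∑ k, pd19 (fun y => w t y j) i x
                    * pd19 (fun y => u t y k) k x * pd19 (fun y => u t y j) i x)
                - (∑ i, ∑ j, ∑ k, pd19 (fun y => w t y j) i x
                    * pd19 (fun y => u t y k) i x * pd19 (fun y => u t y j) k x)
                - (∑ i, ∑ j, ∑ k, pd19 (fun y => u t y j) i x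
                    * pd19 (fun y => u t y k) i x * pd19 (fun y => w t y j) k x)) := by
    simp only [pu, pw]
    rw [← integral_const_mul, ← integral_const_mul, ← integral_sub]
    · refine integral_mono ?_ ?_ fun x => commutator_young
        (fun i j => dirDeriv (spaceVec i) (W j) (t, x))
        (fun i j => dirDeriv (spaceVec i) (U j) (t, x))
      · exact integrableOn_ball_of_continuous (by fun_prop) R
      · exact integrableOn_ball_of_continuous (by fun_prop) R
    · exact integrableOn_ball_of_continuous (by fun_prop) R
    · exact integrableOn_ball_of_continuous (by fun_prop) R
  nlinarith [mul_le_mul_of_nonneg_left hle hμ.le]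

end
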